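/- Let X ∈ ℝ^{m×n} be nonnegative, let A ∈ ℝ^{k×m} satisfy AAᵀ = I_k, let λ ∈ [0,1], and let σ ≥ max{(AᵀA)₋}. Define the objective g(U,V) = ‖A(X−UVᵀ)‖_F² + λ‖(I_m − AᵀA)UVᵀ‖_F² + σ‖1ᵀ(X−UVᵀ)‖² for U ∈ ℝ^{m×r}, V ∈ ℝ^{n×r}, where 1 = 1_m. Then for any entrywise nonnegative U, V for which the respective denominators below are entrywise positive, g does not increase under the updates U ← U ∘ (AᵀAXV + σ11ᵀXV) / ((1−λ)AᵀAUVᵀV + σ11ᵀUVᵀV + λUVᵀV) and V ← V ∘ (XᵀAᵀAU + σXᵀ11ᵀU) / ((1−λ)VUᵀAᵀAU + σVUᵀ11ᵀU + λVUᵀU), and the updated matrices remain entrywise nonnegative. -/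

import Mathlib

open Matrix

/-- Squared Frobenius norm of a real matrix. -/
noncomputable def frobSq {m n : ℕ} (M : Matrix (Fin m) (Fin n) ℝ) : ℝ :=
  ∑ i, ∑ j, (M i j) ^ 2

/-- The all-ones matrix `1_a 1_bᵀ`. -/
def onesMat (a b : ℕ) : Matrix (Fin a) (Fin b) ℝ := Matrix.of fun _ _ => 1

/-- Separable majorization of a quadratic form with nonnegative symmetric coefficients, around a
nonnegative point. -/
lemma dotProduct_mulVec_mul_le {ι : Type*} [Fintype ι] (H : Matrix ι ι ℝ) (hs : H.IsSymm)
    (hH : ∀ i j, 0 ≤ H i j) (x t : ι → ℝ) (hx : ∀ i, 0 ≤ x i) :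
    (x * t) ⬝ᵥ (H *ᵥ (x * t)) ≤ ∑ i, x i * (H *ᵥ x) i * t i ^ 2 := by
  have hl : (x * t) ⬝ᵥ (H *ᵥ (x * t)) = ∑ i, ∑ j, H i j * x i * x j * (t i * t j) := by
    simp only [dotProduct, mulVec, Finset.mul_sum, Pi.mul_apply]
    exact Finset.sum_congr rfl fun i _ => Finset.sum_congr rfl fun j _ => by ring
  have hr : ∑ i, x i * (H *ᵥ x) i * t i ^ 2 = ∑ i, ∑ j, H i j * x i * x j * t i ^ 2 := by
    simp only [dotProduct, mulVec, Finset.mul_sum, Finset.sum_mul]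
    exact Finset.sum_congr rfl fun i _ => Finset.sum_congr rfl fun j _ => by ring
  have hr' : ∑ i, ∑ j, H i j * x i * x j * t i ^ 2 = ∑ i, ∑ j, H i j * x i * x j * t j ^ 2 := by
    rw [Finset.sum_comm]
    exact Finset.sum_congr rfl fun i _ => Finset.sum_congr rfl fun j _ => by
      rw [hs.apply]; ring
  have key : 2 * ∑ i, ∑ j, H i j * x i * x j * (t i * t j) ≤
      ∑ i, ∑ j, H i j * x i * x j * t i ^ 2 + ∑ i, ∑ j, H i j * x i * x j * t j ^ 2 := by
    simp only [Finset.mul_sum, ← Finset.sum_add_distrib]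
    refine Finset.sum_le_sum fun i _ => Finset.sum_le_sum fun j _ => ?_
    nlinarith [mul_nonneg (mul_nonneg (mul_nonneg (hH i j) (hx i)) (hx j)) (sq_nonneg (t i - t j))]
  rw [hl, hr]
  linarith

/-- The multiplicative update does not increase a quadratic function with nonnegative symmetric
coefficients. -/
lemma quadratic_multiplicative_update_le {ι : Type*} [Fintype ι] (H : Matrix ι ι ℝ)
    (hs : H.IsSymm) (hH : ∀ i j, 0 ≤ H i j) (b x : ι → ℝ) (hx : ∀ i, 0 ≤ x i)
    (hd : ∀ i, 0 < (H *ᵥ x) i) :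
    (x * (b / (H *ᵥ x))) ⬝ᵥ (H *ᵥ (x * (b / (H *ᵥ x)))) - 2 * (b ⬝ᵥ (x * (b / (H *ᵥ x)))) ≤
      x ⬝ᵥ (H *ᵥ x) - 2 * (b ⬝ᵥ x) := by
  refine (sub_le_sub_right (dotProduct_mulVec_mul_le H hs hH x _ hx) _).trans ?_
  simp only [dotProduct, Finset.mul_sum, ← Finset.sum_sub_distrib, Pi.mul_apply, Pi.div_apply]
  refine Finset.sum_le_sum fun i _ => ?_
  have hi := hd i
  have h : x i * (H *ᵥ x) i - 2 * (b i * x i) -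
      (x i * (H *ᵥ x) i * (b i / (H *ᵥ x) i) ^ 2 - 2 * (b i * (x i * (b i / (H *ᵥ x) i)))) =
      x i * (((H *ᵥ x) i - b i) ^ 2 / (H *ᵥ x) i) := by
    field_simp
    ring
  have : 0 ≤ x i * (((H *ᵥ x) i - b i) ^ 2 / (H *ᵥ x) i) :=
    mul_nonneg (hx i) (div_nonneg (sq_nonneg _) hi.le)
  linarith

open scoped Kronecker in
/-- The matrix form of `quadratic_multiplicative_update_le`, for the quadratic form
`Y ↦ trace (Yᵀ * (S * Y * T))`. -/
lemma trace_multiplicative_update_le {p q : Type*} [Fintype p] [Fintype q]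
    (S : Matrix p p ℝ) (T : Matrix q q ℝ)
    (hS : S.IsSymm) (hT : T.IsSymm) (hS0 : ∀ i j, 0 ≤ S i j) (hT0 : ∀ i j, 0 ≤ T i j)
    (B D Y : Matrix p q ℝ) (hY : ∀ i a, 0 ≤ Y i a) (hD : D = S * Y * T)
    (hD0 : ∀ i a, 0 < D i a) (Z : Matrix p q ℝ) (hZ : ∀ i a, Z i a = Y i a * B i a / D i a) :
    trace (Zᵀ * (S * Z * T)) - 2 * trace (Bᵀ * Z) ≤
      trace (Yᵀ * (S * Y * T)) - 2 * trace (Bᵀ * Y) := by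
  have hk : ∀ M : Matrix p q ℝ, (T ⊗ₖ S) *ᵥ vec M = vec (S * M * T) := fun M => by
    rw [kronecker_mulVec_vec, hT.eq]
  have hZv : vec Z = vec Y * (vec B / ((T ⊗ₖ S) *ᵥ vec Y)) := by
    rw [hk, ← hD]
    ext ⟨a, i⟩
    simp [vec, hZ, mul_div_assoc]
  have h := quadratic_multiplicative_update_le (T ⊗ₖ S)
    (by rw [IsSymm, ← kroneckerMap_transpose, hT.eq, hS.eq])
    (fun i j => mul_nonneg (hT0 _ _) (hS0 _ _)) (vec B) (vec Y) (fun i => hY _ _)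
    (fun i => by rw [hk, ← hD]; exact hD0 _ _)
  rw [← hZv, hk, hk] at h
  simpa only [vec_dotProduct_vec] using h

lemma frobSq_eq_trace {m n : ℕ} (M : Matrix (Fin m) (Fin n) ℝ) :
    frobSq M = trace (Mᵀ * M) := by
  rw [frobSq, Finset.sum_comm]
  simp [trace, mul_apply, sq]

lemma sum_sq_sum_eq_trace {m n : ℕ} (M : Matrix (Fin m) (Fin n) ℝ) :
    ∑ j, (∑ i, M i j) ^ 2 = trace (Mᵀ * onesMat m m * M) := by
  simp [trace, mul_apply, onesMat, sq, Finset.mul_sum]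

lemma onesMat_isSymm (m : ℕ) : (onesMat m m).IsSymm := by
  ext i j
  simp [onesMat]

lemma trace_transpose_mul_mul_sub {p q : Type*} [Fintype p] [Fintype q] {S : Matrix p p ℝ}
    (hS : S.IsSymm) (X W : Matrix p q ℝ) :
    trace ((X - W)ᵀ * S * (X - W)) =
      trace (Xᵀ * S * X) - 2 * trace (Xᵀ * S * W) + trace (Wᵀ * S * W) := by
  have h : trace (Wᵀ * S * X) = trace (Xᵀ * S * W) := by
    rw [← trace_transpose]
    simp [hS.eq, Matrix.mul_assoc]
  simp only [transpose_sub, Matrix.sub_mul, Matrix.mul_sub, trace_sub, h]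
  ring

lemma mul_apply_nonneg {p q s : Type*} [Fintype q] {M : Matrix p q ℝ} {N : Matrix q s ℝ}
    (hM : ∀ i j, 0 ≤ M i j) (hN : ∀ i j, 0 ≤ N i j) (i : p) (j : s) : 0 ≤ (M * N) i j :=
  Finset.sum_nonneg fun _ _ => mul_nonneg (hM _ _) (hN _ _)

/-- The objective as a quadratic function of `W = U * Vᵀ`. -/
lemma objective_eq {m n k : ℕ} (X W : Matrix (Fin m) (Fin n) ℝ) (A : Matrix (Fin k) (Fin m) ℝ)
    (hA : A * Aᵀ = 1) (lam σ : ℝ) :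
    frobSq (A * (X - W)) + lam * frobSq ((1 - Aᵀ * A) * W)
        + σ * ∑ j, (∑ i, (X - W) i j) ^ 2 =
      trace (Xᵀ * (Aᵀ * A + σ • onesMat m m) * X)
        - 2 * trace (Xᵀ * (Aᵀ * A + σ • onesMat m m) * W)
        + trace (Wᵀ * ((1 - lam) • (Aᵀ * A) + σ • onesMat m m + lam • 1) * W) := by
  have hP : (Aᵀ * A).IsSymm := by simp [IsSymm]
  have h1 : frobSq (A * (X - W)) = trace ((X - W)ᵀ * (Aᵀ * A) * (X - W)) := by
    rw [frobSq_eq_trace, transpose_mul]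
    simp only [Matrix.mul_assoc]
  have hidem : Aᵀ * A * (Aᵀ * A) = Aᵀ * A := by
    rw [Matrix.mul_assoc, ← Matrix.mul_assoc A, hA, Matrix.one_mul]
  have h2 : frobSq ((1 - Aᵀ * A) * W) = trace (Wᵀ * W) - trace (Wᵀ * (Aᵀ * A) * W) := by
    have hQ : (1 - Aᵀ * A)ᵀ * (1 - Aᵀ * A) = 1 - Aᵀ * A := by
      rw [transpose_sub, transpose_one, hP.eq, Matrix.sub_mul, Matrix.mul_sub, Matrix.mul_sub, hidem]
      simp
    rw [frobSq_eq_trace, transpose_mul, Matrix.mul_assoc, ← Matrix.mul_assoc _ _ W, hQ,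
      ← Matrix.mul_assoc, Matrix.mul_sub, Matrix.sub_mul, trace_sub, Matrix.mul_one]
  rw [h1, h2, sum_sq_sum_eq_trace, trace_transpose_mul_mul_sub hP,
    trace_transpose_mul_mul_sub (onesMat_isSymm m)]
  simp only [Matrix.mul_add, Matrix.add_mul, Matrix.mul_smul, Matrix.smul_mul, trace_add,
    trace_smul, smul_eq_mul, Matrix.mul_one]
  ring

/-- Multiplicative updates for the one-sided compressed NMF objective with an
orthonormal-row sketching matrix, projection regularizer, and
nonnegativity-correction shift (Corollary: one-sided updates, orthogonal A). -/
theorem one_sided_orthogonal_multiplicative_updates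
    {m n r k : ℕ}
    (X : Matrix (Fin m) (Fin n) ℝ) (hX : ∀ i j, 0 ≤ X i j)
    (A : Matrix (Fin k) (Fin m) ℝ) (hA : A * Aᵀ = 1)
    (lam : ℝ) (hlam0 : 0 ≤ lam) (hlam1 : lam ≤ 1)
    (σ : ℝ) (hσ : ∀ i j, max (-((Aᵀ * A) i j)) 0 ≤ σ)
    (g : Matrix (Fin m) (Fin r) ℝ → Matrix (Fin n) (Fin r) ℝ → ℝ)
    (hg : ∀ U V, g U V =
      frobSq (A * (X - U * Vᵀ)) + lam * frobSq ((1 - Aᵀ * A) * (U * Vᵀ))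
        + σ * ∑ j, (∑ i, (X - U * Vᵀ) i j) ^ 2)
    (U : Matrix (Fin m) (Fin r) ℝ) (V : Matrix (Fin n) (Fin r) ℝ)
    (hU : ∀ i a, 0 ≤ U i a) (hV : ∀ i a, 0 ≤ V i a)
    (NumU DenU : Matrix (Fin m) (Fin r) ℝ)
    (hNumU : NumU = Aᵀ * A * X * V + σ • (onesMat m m * X * V))
    (hDenU : DenU = (1 - lam) • (Aᵀ * A * U * Vᵀ * V)
      + σ • (onesMat m m * U * Vᵀ * V) + lam • (U * Vᵀ * V))
    (NumV DenV : Matrix (Fin n) (Fin r) ℝ)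
    (hNumV : NumV = Xᵀ * Aᵀ * A * U + σ • (Xᵀ * onesMat m m * U))
    (hDenV : DenV = (1 - lam) • (V * Uᵀ * Aᵀ * A * U)
      + σ • (V * Uᵀ * onesMat m m * U) + lam • (V * Uᵀ * U)) :
    ((∀ i a, 0 < DenU i a) →
      (∀ i a, 0 ≤ (Matrix.of fun i a => U i a * NumU i a / DenU i a :
        Matrix (Fin m) (Fin r) ℝ) i a) ∧
      g (Matrix.of fun i a => U i a * NumU i a / DenU i a) V ≤ g U V)
    ∧ ((∀ i a, 0 < DenV i a) →
      (∀ i a, 0 ≤ (Matrix.of fun i a => V i a * NumV i a / DenV i a :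
        Matrix (Fin n) (Fin r) ℝ) i a) ∧
      g U (Matrix.of fun i a => V i a * NumV i a / DenV i a) ≤ g U V) := by
  have hP : (Aᵀ * A).IsSymm := by simp [IsSymm]
  have hJ := onesMat_isSymm m
  set P : Matrix (Fin m) (Fin m) ℝ := Aᵀ * A + σ • onesMat m m with hPdef
  set Q : Matrix (Fin m) (Fin m) ℝ := (1 - lam) • (Aᵀ * A) + σ • onesMat m m + lam • 1 with hQdef
  have hPs : P.IsSymm := hP.add (hJ.smul σ)
  have hQs : Q.IsSymm := ((hP.smul _).add (hJ.smul σ)).add (isSymm_one.smul lam)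
  have hP0 : ∀ i j, 0 ≤ P i j := fun i j => by
    have := (le_max_left _ _).trans (hσ i j)
    simp only [hPdef, Matrix.add_apply, Matrix.smul_apply, onesMat, of_apply, smul_eq_mul]
    linarith
  have hQ0 : ∀ i j, 0 ≤ Q i j := fun i j => by
    have h1 := (le_max_left _ _).trans (hσ i j)
    have h2 := (le_max_right _ _).trans (hσ i j)
    have h3 : (0 : ℝ) ≤ (1 : Matrix (Fin m) (Fin m) ℝ) i j := by
      rw [one_apply]; split_ifs <;> norm_num
    simp only [hQdef, Matrix.add_apply, Matrix.smul_apply, onesMat, of_apply, smul_eq_mul]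
    nlinarith [mul_nonneg hlam0 h3, mul_nonneg hlam0 h2,
      mul_nonneg (sub_nonneg.2 hlam1) (neg_le_iff_add_nonneg.1 h1)]
  have hNU : NumU = P * X * V := by
    simp only [hNumU, hPdef, Matrix.add_mul, Matrix.smul_mul]
  have hDU : DenU = Q * U * (Vᵀ * V) := by
    simp only [hDenU, hQdef, Matrix.add_mul, Matrix.smul_mul, Matrix.one_mul, ← Matrix.mul_assoc]
  have hNV : NumV = Xᵀ * P * U := by
    simp only [hNumV, hPdef, Matrix.add_mul, Matrix.mul_add, Matrix.smul_mul, Matrix.mul_smul,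
      ← Matrix.mul_assoc]
  have hDV : DenV = (1 : Matrix (Fin n) (Fin n) ℝ) * V * (Uᵀ * Q * U) := by
    simp only [hDenV, hQdef, Matrix.add_mul, Matrix.mul_add, Matrix.smul_mul, Matrix.mul_smul,
      Matrix.one_mul, Matrix.mul_one, ← Matrix.mul_assoc]
  have hNU0 : ∀ i a, 0 ≤ NumU i a := hNU ▸ mul_apply_nonneg (mul_apply_nonneg hP0 hX) hV
  have hNV0 : ∀ i a, 0 ≤ NumV i a :=
    hNV ▸ mul_apply_nonneg (mul_apply_nonneg (fun i j => hX j i) hP0) hU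
  have hgU : ∀ Y, g Y V = trace (Xᵀ * P * X) +
      (trace (Yᵀ * (Q * Y * (Vᵀ * V))) - 2 * trace (NumUᵀ * Y)) := fun Y => by
    have h1 : trace (NumUᵀ * Y) = trace (Xᵀ * P * (Y * Vᵀ)) := by
      rw [hNU, transpose_mul, transpose_mul, hPs.eq, Matrix.mul_assoc, trace_mul_comm,
        Matrix.mul_assoc (Xᵀ * P)]
    have h2 : trace (Yᵀ * (Q * Y * (Vᵀ * V))) = trace ((Y * Vᵀ)ᵀ * Q * (Y * Vᵀ)) := by
      rw [transpose_mul, transpose_transpose, Matrix.mul_assoc V, Matrix.mul_assoc V,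
        trace_mul_comm V]
      simp only [Matrix.mul_assoc]
    rw [hg, objective_eq _ _ _ hA, h1, h2]
    ring
  have hgV : ∀ Y, g U Y = trace (Xᵀ * P * X) +
      (trace (Yᵀ * ((1 : Matrix (Fin n) (Fin n) ℝ) * Y * (Uᵀ * Q * U))) - 2 * trace (NumVᵀ * Y)) := fun Y => by
    have h1 : trace (NumVᵀ * Y) = trace (Xᵀ * P * (U * Yᵀ)) := by
      rw [hNV, ← trace_transpose, transpose_mul, transpose_transpose, trace_mul_comm,
        Matrix.mul_assoc (Xᵀ * P)]
    have h2 : trace (Yᵀ * ((1 : Matrix (Fin n) (Fin n) ℝ) * Y * (Uᵀ * Q * U))) = trace ((U * Yᵀ)ᵀ * Q * (U * Yᵀ)) := by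
      rw [Matrix.one_mul, trace_mul_comm, transpose_mul, transpose_transpose]
      simp only [Matrix.mul_assoc]
    rw [hg, objective_eq _ _ _ hA, h1, h2]
    ring
  refine ⟨fun hD => ⟨fun i a => div_nonneg (mul_nonneg (hU i a) (hNU0 i a)) (hD i a).le, ?_⟩,
    fun hD => ⟨fun i a => div_nonneg (mul_nonneg (hV i a) (hNV0 i a)) (hD i a).le, ?_⟩⟩
  · rw [hgU, hgU]
    exact (add_le_add_iff_left _).2 (trace_multiplicative_update_le Q (Vᵀ * V) hQs
      (by simp [IsSymm]) hQ0 (mul_apply_nonneg (fun i j => hV j i) hV) NumU DenU U hU hDU hD _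
      fun _ _ => rfl)
  · rw [hgV, hgV]
    exact (add_le_add_iff_left _).2 (trace_multiplicative_update_le 1 (Uᵀ * Q * U) isSymm_one
      (by simp [IsSymm, hQs.eq, Matrix.mul_assoc])
      (fun i j => by rw [one_apply]; split_ifs <;> norm_num)
      (mul_apply_nonneg (mul_apply_nonneg (fun i j => hU j i) hQ0) hU) NumV DenV V hV hDV hD _
      fun _ _ => rfl)
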